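/- Let X be a set, 𝒜 a Boolean algebra of subsets of X, and μ a finitely additive probability measure on 𝒜 which is purely atomic in the following sense: there are a finite or countably infinite family (p_i)_{i∈I} of pairwise distinct ultrafilters on 𝒜 and positive reals (α_i)_{i∈I} with Σ_{i∈I} α_i = 1 such that μ(A) = Σ_{i∈I} α_i·p_i(A) for every A ∈ 𝒜. Then for every ε > 0 there is a finite partition X = V₁ ∪ … ∪ V_n with each V_j ∈ 𝒜 such that for each j ≤ n there is an index i_j ∈ I with V_j ∈ p_{i_j} and μ(V_j ∖ D) ≤ ε·μ(V_j) for every D ∈ p_{i_j}; in particular each V_j has μ(V_j) ≥ α_{i_j} > 0 and is ε-concentrated on a single ultrafilter of positive weight. -/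

import Mathlib

/-!
STATEMENT 13: If `μ` is a purely atomic finitely additive probability measure on a
Boolean algebra `𝒜` of subsets of `X` (a countable weighted sum of distinct
ultrafilters with positive weights), then for every `ε > 0` there is a finite
partition of `X` into members of `𝒜` each of which is `ε`-concentrated on a single
ultrafilter of positive weight.
-/

/-- `𝒜` is a Boolean algebra of subsets of `X`: it contains `X` and is closed under
complementation and finite intersection. -/
def IsBoolAlg {X : Type*} (𝒜 : Set (Set X)) : Prop :=
  Set.univ ∈ 𝒜 ∧ (∀ A ∈ 𝒜, Aᶜ ∈ 𝒜) ∧ ∀ A ∈ 𝒜, ∀ B ∈ 𝒜, A ∩ B ∈ 𝒜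

/-- `μ` is a finitely additive probability measure on the algebra `𝒜` of subsets of `X`. -/
def IsFinAddProb {X : Type*} (𝒜 : Set (Set X)) (μ : Set X → ℝ) : Prop :=
  (∀ A ∈ 𝒜, 0 ≤ μ A) ∧ μ Set.univ = 1 ∧
    ∀ A ∈ 𝒜, ∀ B ∈ 𝒜, Disjoint A B → μ (A ∪ B) = μ A + μ B

/-- An ultrafilter on the algebra `𝒜`, viewed as a `{0,1}`-valued finitely additive
probability measure on `𝒜`.  For `A ∈ 𝒜`, "`A ∈ p`" means `p A = 1`. -/
def IsUltraOn {X : Type*} (𝒜 : Set (Set X)) (p : Set X → ℝ) : Prop :=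
  IsFinAddProb 𝒜 p ∧ ∀ A ∈ 𝒜, p A = 0 ∨ p A = 1

namespace IsBoolAlg

variable {X : Type*} {𝒜 : Set (Set X)}

theorem diff_mem (h : IsBoolAlg 𝒜) {A B : Set X} (hA : A ∈ 𝒜) (hB : B ∈ 𝒜) : A \ B ∈ 𝒜 :=
  h.2.2 A hA _ (h.2.1 B hB)

theorem biInter_mem {ι : Type*} (h : IsBoolAlg 𝒜) (s : Finset ι) {f : ι → Set X}
    (hf : ∀ i ∈ s, f i ∈ 𝒜) : (⋂ i ∈ s, f i) ∈ 𝒜 := by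
  classical
  induction s using Finset.induction_on with
  | empty => simpa using h.1
  | insert a s _ ih =>
    rw [Finset.set_biInter_insert]
    exact h.2.2 _ (hf a (by simp)) _ (ih fun i hi => hf i (by simp [hi]))

end IsBoolAlg

namespace IsFinAddProb

variable {X : Type*} {𝒜 : Set (Set X)} {μ : Set X → ℝ}

theorem inter_add_diff (hμ : IsFinAddProb 𝒜 μ) (h : IsBoolAlg 𝒜) {A B : Set X}
    (hA : A ∈ 𝒜) (hB : B ∈ 𝒜) : μ (A ∩ B) + μ (A \ B) = μ A := by
  rw [← hμ.2.2 _ (h.2.2 A hA B hB) _ (h.diff_mem hA hB) Set.disjoint_sdiff_inter.symm,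
    Set.inter_union_sdiff]

theorem mono (hμ : IsFinAddProb 𝒜 μ) (h : IsBoolAlg 𝒜) {A B : Set X}
    (hA : A ∈ 𝒜) (hB : B ∈ 𝒜) (hAB : A ⊆ B) : μ A ≤ μ B := by
  have h1 := hμ.inter_add_diff h hB hA
  have h2 := hμ.1 _ (h.diff_mem hB hA)
  rw [Set.inter_eq_self_of_subset_right hAB] at h1
  linarith

theorem le_one (hμ : IsFinAddProb 𝒜 μ) (h : IsBoolAlg 𝒜) {A : Set X} (hA : A ∈ 𝒜) :
    μ A ≤ 1 :=
  hμ.2.1 ▸ hμ.mono h hA h.1 (Set.subset_univ A)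

theorem add_compl (hμ : IsFinAddProb 𝒜 μ) (h : IsBoolAlg 𝒜) {A : Set X} (hA : A ∈ 𝒜) :
    μ A + μ Aᶜ = 1 := by
  rw [← hμ.2.2 A hA _ (h.2.1 A hA) disjoint_compl_right, Set.union_compl_self, hμ.2.1]

theorem inter_eq_one (hμ : IsFinAddProb 𝒜 μ) (h : IsBoolAlg 𝒜) {A B : Set X}
    (hA : A ∈ 𝒜) (hB : B ∈ 𝒜) (hA1 : μ A = 1) (hB1 : μ B = 1) : μ (A ∩ B) = 1 := by
  have h1 := hμ.inter_add_diff h hA hB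
  have h2 := hμ.mono h (h.diff_mem hA hB) (h.2.1 B hB) (fun x hx => hx.2)
  have h3 := hμ.add_compl h hB
  have h4 := hμ.le_one h (h.2.2 A hA B hB)
  linarith

theorem biInter_eq_one {ι : Type*} (hμ : IsFinAddProb 𝒜 μ) (h : IsBoolAlg 𝒜) (s : Finset ι)
    {f : ι → Set X} (hf : ∀ i ∈ s, f i ∈ 𝒜) (hf1 : ∀ i ∈ s, μ (f i) = 1) :
    μ (⋂ i ∈ s, f i) = 1 := by
  classical
  induction s using Finset.induction_on with
  | empty => simpa using hμ.2.1
  | insert a s _ ih =>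
    rw [Finset.set_biInter_insert]
    exact hμ.inter_eq_one h (hf a (by simp)) (h.biInter_mem s fun i hi => hf i (by simp [hi]))
      (hf1 a (by simp)) (ih (fun i hi => hf i (by simp [hi])) fun i hi => hf1 i (by simp [hi]))

theorem eq_zero_of_subset (hμ : IsFinAddProb 𝒜 μ) (h : IsBoolAlg 𝒜) {A B : Set X}
    (hA : A ∈ 𝒜) (hB : B ∈ 𝒜) (hAB : A ⊆ B) (hB0 : μ B = 0) : μ A = 0 :=
  le_antisymm (hB0 ▸ hμ.mono h hA hB hAB) (hμ.1 A hA)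

theorem eq_zero_of_disjoint (hμ : IsFinAddProb 𝒜 μ) (h : IsBoolAlg 𝒜) {A B : Set X}
    (hA : A ∈ 𝒜) (hB : B ∈ 𝒜) (hAB : Disjoint A B) (hB1 : μ B = 1) : μ A = 0 :=
  hμ.eq_zero_of_subset h hA (h.2.1 B hB) hAB.subset_compl_right
    (by linarith [hμ.add_compl h hB])

end IsFinAddProb

section Ultrafilters

variable {X I : Type*} {𝒜 : Set (Set X)} {p : I → Set X → ℝ}

theorem IsUltraOn.exists_separating (h : IsBoolAlg 𝒜) {p q : Set X → ℝ}
    (hp : IsUltraOn 𝒜 p) (hq : IsUltraOn 𝒜 q) (hpq : ∃ A ∈ 𝒜, p A ≠ q A) :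
    ∃ A ∈ 𝒜, p A = 1 ∧ q A = 0 := by
  obtain ⟨A, hA, hne⟩ := hpq
  have hpA := hp.1.add_compl h hA
  have hqA := hq.1.add_compl h hA
  rcases hp.2 A hA with h0 | h1 <;> rcases hq.2 A hA with k0 | k1
  · exact absurd (h0.trans k0.symm) hne
  · exact ⟨Aᶜ, h.2.1 A hA, by linarith, by linarith⟩
  · exact ⟨A, hA, h1, k0⟩
  · exact absurd (h1.trans k1.symm) hne

theorem IsUltraOn.exists_separating_finset (h : IsBoolAlg 𝒜) (hult : ∀ i, IsUltraOn 𝒜 (p i))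
    (hdist : ∀ i j, i ≠ j → ∃ A ∈ 𝒜, p i A ≠ p j A) (i : I) (F : Finset I) :
    ∃ A ∈ 𝒜, p i A = 1 ∧ ∀ j ∈ F, j ≠ i → p j A = 0 := by
  classical
  have hsep : ∀ j, ∃ A ∈ 𝒜, p i A = 1 ∧ (j ≠ i → p j A = 0) := by
    intro j
    by_cases hj : j = i
    · exact ⟨Set.univ, h.1, (hult i).1.2.1, fun hne => absurd hj hne⟩
    · obtain ⟨A, hA, hi, hj⟩ :=
        exists_separating h (hult i) (hult j) (hdist i j (Ne.symm hj))
      exact ⟨A, hA, hi, fun _ => hj⟩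
  choose B hB hBi hBj using hsep
  refine ⟨⋂ j ∈ F, B j, h.biInter_mem F fun j _ => hB j,
    (hult i).1.biInter_eq_one h F (fun j _ => hB j) fun j _ => hBi j, fun j hj hne => ?_⟩
  exact (hult j).1.eq_zero_of_subset h (h.biInter_mem F fun j _ => hB j) (hB j)
    (Set.biInter_subset_of_mem hj) (hBj j hne)

/-- Finitely many distinct ultrafilters are concentrated on the cells of a finite partition, where
each cell other than a chosen one lies inside a prescribed neighbourhood of its ultrafilter. -/
theorem IsUltraOn.exists_partition (h : IsBoolAlg 𝒜) (hult : ∀ i, IsUltraOn 𝒜 (p i))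
    (F : Finset I) {i₀ : I} (hi₀ : i₀ ∈ F) {U : I → Set X} (hU : ∀ i, U i ∈ 𝒜)
    (hU1 : ∀ i, p i (U i) = 1) (hU0 : ∀ i, ∀ j ∈ F, j ≠ i → p j (U i) = 0) :
    ∃ V : F → Set X, (∀ i, V i ∈ 𝒜) ∧ (⋃ i, V i) = Set.univ ∧
      Pairwise (Function.onFun Disjoint V) ∧ (∀ i : F, p i (V i) = 1) ∧
      ∀ i : F, (i : I) ≠ i₀ → V i ⊆ U i := by
  classical
  have hUc : ∀ i, (U i)ᶜ ∈ 𝒜 := fun i => h.2.1 _ (hU i)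
  set W : I → Set X := fun i => U i ∩ ⋂ j ∈ F.erase i, (U j)ᶜ with hW
  have hWmem : ∀ i, W i ∈ 𝒜 := fun i => h.2.2 _ (hU i) _ (h.biInter_mem _ fun j _ => hUc j)
  have hWc : ∀ i, (W i)ᶜ ∈ 𝒜 := fun i => h.2.1 _ (hWmem i)
  have hW1 : ∀ i ∈ F, p i (W i) = 1 := fun i hi =>
    (hult i).1.inter_eq_one h (hU i) (h.biInter_mem _ fun j _ => hUc j) (hU1 i)
      ((hult i).1.biInter_eq_one h _ (fun j _ => hUc j) fun j hj => by
        linarith [(hult i).1.add_compl h (hU j), hU0 j i hi (Finset.ne_of_mem_erase hj).symm])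
  have hWdisj : ∀ i ∈ F, ∀ j ∈ F, i ≠ j → Disjoint (W i) (W j) := by
    intro i hi j hj hij
    refine Set.disjoint_left.2 fun x hxi hxj => ?_
    exact Set.mem_iInter₂.1 hxi.2 j (Finset.mem_erase.2 ⟨hij.symm, hj⟩) hxj.1
  set R : Set X := ⋂ j ∈ F.erase i₀, (W j)ᶜ with hR
  have hRdisj : ∀ i ∈ F, i ≠ i₀ → Disjoint R (W i) := fun i hi hne =>
    Set.disjoint_left.2 fun x hx => Set.mem_iInter₂.1 hx i (Finset.mem_erase.2 ⟨hne, hi⟩)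
  have hR1 : p i₀ R = 1 :=
    (hult i₀).1.biInter_eq_one h _ (fun j _ => hWc j) fun j hj => by
      have hj' := Finset.mem_erase.1 hj
      linarith [(hult i₀).1.add_compl h (hWmem j), (hult i₀).1.eq_zero_of_disjoint h (hWmem j)
        (hWmem i₀) (hWdisj j hj'.2 i₀ hi₀ hj'.1) (hW1 i₀ hi₀)]
  refine ⟨fun i => if (i : I) = i₀ then R else W i, fun i => ?_, ?_, ?_, fun i => ?_,
    fun i hne => ?_⟩
  · dsimp only
    split_ifs
    · exact h.biInter_mem _ fun j _ => hWc j
    · exact hWmem i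
  · refine Set.eq_univ_of_forall fun x => Set.mem_iUnion.2 ?_
    by_cases hx : x ∈ R
    · exact ⟨⟨i₀, hi₀⟩, by simpa using hx⟩
    · simp only [hR, Set.mem_iInter, not_forall, Set.mem_compl_iff, not_not] at hx
      obtain ⟨j, hj, hxj⟩ := hx
      have hj' := Finset.mem_erase.1 hj
      exact ⟨⟨j, hj'.2⟩, by simpa [hj'.1] using hxj⟩
  · intro i j hij
    have hij' : (i : I) ≠ j := fun e => hij (Subtype.ext e)
    simp only [Function.onFun]
    split_ifs with hi hj hj
    · exact absurd (hi.trans hj.symm) hij'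
    · exact hRdisj j j.2 hj
    · exact (hRdisj i i.2 hi).symm
    · exact hWdisj i i.2 j j.2 hij'
  · dsimp only
    split_ifs with hi
    · rw [hi]; exact hR1
    · exact hW1 i i.2
  · simp only [if_neg hne]
    exact Set.inter_subset_left

end Ultrafilters

section Atomic

variable {X I : Type*} {𝒜 : Set (Set X)} {μ : Set X → ℝ} {p : I → Set X → ℝ} {α : I → ℝ}

theorem weight_le_measure (hult : ∀ i, IsUltraOn 𝒜 (p i)) (hpos : ∀ i, 0 < α i)
    (hatomic : ∀ A ∈ 𝒜, HasSum (fun i => α i * p i A) (μ A)) {A : Set X} (hA : A ∈ 𝒜) {i : I}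
    (hi : p i A = 1) : α i ≤ μ A := by
  simpa [hi] using
    le_hasSum (hatomic A hA) i fun j _ => mul_nonneg (hpos j).le ((hult j).1.1 A hA)

theorem measure_le_weight_add (h : IsBoolAlg 𝒜) (hult : ∀ i, IsUltraOn 𝒜 (p i))
    (hpos : ∀ i, 0 < α i) (hsum : HasSum α 1)
    (hatomic : ∀ A ∈ 𝒜, HasSum (fun i => α i * p i A) (μ A)) {A : Set X} (hA : A ∈ 𝒜) {i : I}
    {F : Finset I} {δ : ℝ} (hF : 1 - δ ≤ ∑ j ∈ F, α j)
    (hzero : ∀ j ∈ F, j ≠ i → p j A = 0) : μ A ≤ α i + δ := by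
  classical
  have hfin : HasSum (fun j => if j ∈ F.erase i then α j else 0) (∑ j ∈ F.erase i, α j) := by
    have := hasSum_sum_of_ne_finset_zero (L := SummationFilter.unconditional I)
      (f := fun j => if j ∈ F.erase i then α j else 0) (s := F.erase i)
      (fun j hj => if_neg hj)
    rwa [Finset.sum_congr rfl fun j hj => if_pos hj] at this
  have hle : μ A ≤ 1 - ∑ j ∈ F.erase i, α j := by
    refine hasSum_le (fun j => ?_) (hatomic A hA) (hsum.sub hfin)
    split_ifs with hj
    · simp [hzero j (Finset.mem_of_mem_erase hj) (Finset.ne_of_mem_erase hj)]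
    · simpa using mul_le_of_le_one_right (hpos j).le ((hult j).1.le_one h hA)
  have hFi : ∑ j ∈ F, α j ≤ α i + ∑ j ∈ F.erase i, α j := by
    by_cases hi : i ∈ F
    · exact (Finset.add_sum_erase F α hi).ge
    · rw [Finset.erase_eq_of_notMem hi]
      linarith [hpos i]
  linarith

theorem HasSum.exists_superset_sub_le_sum (hpos : ∀ i, 0 < α i) {a : ℝ} (hsum : HasSum α a)
    (F : Finset I) {δ : ℝ} (hδ : 0 < δ) : ∃ G : Finset I, F ⊆ G ∧ a - δ ≤ ∑ j ∈ G, α j := by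
  classical
  obtain ⟨G, hG⟩ := (hsum.eventually_const_lt (sub_lt_self a hδ)).exists
  exact ⟨F ∪ G, Finset.subset_union_left, hG.le.trans
    (Finset.sum_le_sum_of_subset_of_nonneg Finset.subset_union_right fun j _ _ => (hpos j).le)⟩

end Atomic

theorem atomic_measure_concentrated_partition
    {X : Type*} (𝒜 : Set (Set X)) (h𝒜 : IsBoolAlg 𝒜)
    (μ : Set X → ℝ) (hμ : IsFinAddProb 𝒜 μ)
    (I : Type*) (hI : Countable I) (p : I → Set X → ℝ) (α : I → ℝ)
    (hult : ∀ i, IsUltraOn 𝒜 (p i))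
    (hdist : ∀ i j, i ≠ j → ∃ A ∈ 𝒜, p i A ≠ p j A)
    (hpos : ∀ i, 0 < α i) (hsum : HasSum α 1)
    (hatomic : ∀ A ∈ 𝒜, HasSum (fun i => α i * p i A) (μ A))
    (ε : ℝ) (hε : 0 < ε) :
    ∃ (n : ℕ) (V : Fin n → Set X),
      (∀ j, V j ∈ 𝒜) ∧
      (⋃ j, V j) = Set.univ ∧
      Pairwise (Function.onFun Disjoint V) ∧
      ∀ j, ∃ i : I,
        p i (V j) = 1 ∧
        (∀ D ∈ 𝒜, p i D = 1 → μ (V j \ D) ≤ ε * μ (V j)) ∧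
        α i ≤ μ (V j) := by
  obtain ⟨i₀⟩ : Nonempty I := by
    by_contra hne
    rw [not_nonempty_iff] at hne
    exact zero_ne_one (hasSum_empty.unique hsum)
  have hδ : ∀ i, 0 < ε * α i := fun i => mul_pos hε (hpos i)
  obtain ⟨F, hiF, hF⟩ := hsum.exists_superset_sub_le_sum hpos {i₀} (hδ i₀)
  have hi₀ : i₀ ∈ F := hiF (Finset.mem_singleton_self i₀)
  choose G hFG hG using fun i => hsum.exists_superset_sub_le_sum hpos F (hδ i)
  choose U hU hU1 hU0 using fun i =>
    IsUltraOn.exists_separating_finset h𝒜 hult hdist i (G i)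
  obtain ⟨V, hV, hcover, hdisj, hV1, hVU⟩ := IsUltraOn.exists_partition h𝒜 hult F hi₀ hU hU1
    fun i j hj => hU0 i j (hFG i hj)
  have hVle : ∀ i : F, μ (V i) ≤ α i + ε * α i := by
    intro i
    by_cases hi : (i : I) = i₀
    · refine measure_le_weight_add h𝒜 hult hpos hsum hatomic (hV i) (F := F) (hi ▸ hF) ?_
      intro j hj hne
      exact (hult j).1.eq_zero_of_disjoint h𝒜 (hV i) (hV ⟨j, hj⟩)
        (hdisj fun e => hne (congrArg Subtype.val e).symm) (hV1 ⟨j, hj⟩)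
    · exact (hμ.mono h𝒜 (hV i) (hU i) (hVU i hi)).trans
        (measure_le_weight_add h𝒜 hult hpos hsum hatomic (hU i) (hG i) (hU0 i))
  let e := F.equivFin.symm
  refine ⟨F.card, fun j => V (e j), fun j => hV _, ?_, fun j k hjk => hdisj (e.injective.ne hjk),
    fun j => ⟨e j, hV1 _, fun D hD hD1 => ?_,
      weight_le_measure hult hpos hatomic (hV _) (hV1 _)⟩⟩
  · rw [← hcover]
    exact e.surjective.iUnion_comp V
  · have hsplit := hμ.inter_add_diff h𝒜 (hV (e j)) hD
    have hinter := weight_le_measure hult hpos hatomic (h𝒜.2.2 _ (hV (e j)) D hD)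
      ((hult _).1.inter_eq_one h𝒜 (hV (e j)) hD (hV1 _) hD1)
    have hweight := mul_le_mul_of_nonneg_left
      (weight_le_measure hult hpos hatomic (hV (e j)) (hV1 _)) hε.le
    linarith [hVle (e j)]
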